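/- arXiv:2508.07727 — 7 statements merged into one kernel-verified Lean document; each statement's English description precedes it below -/
import Mathlib

section
/- Let Δ₁ ⊆ ℂ be a closed cone that is closed under addition and pairwise-acute, and let Δ₂ ⊆ ℂ be a closed cone with (−Δ₁) ∩ Δ₂ ⊆ {0}. Then for every t ∈ ℂ and every L ≥ 0 the set (Δ₁ + t + Δ₂) ∩ { z ∈ ℂ | ∃ w ∈ Δ₁, ‖z + w‖ ≤ L } is a bounded subset of ℂ. -/
/-- Boundedness claim (3.24) of the paper: for a closed, additively closed,
pairwise-acute cone `Δ₁` and a closed cone `Δ₂` with `(−Δ₁) ∩ Δ₂ ⊆ {0}`,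
for every `t ∈ ℂ` and `L ≥ 0` the set
`(Δ₁ + t + Δ₂) ∩ { z | ∃ w ∈ Δ₁, ‖z + w‖ ≤ L }` is bounded. -/
theorem stmt_4 (Δ₁ Δ₂ : Set ℂ)
    (h₁closed : IsClosed Δ₁) (h₁0 : (0 : ℂ) ∈ Δ₁)
    (h₁cone : ∀ r : ℝ, 0 ≤ r → ∀ z ∈ Δ₁, (r : ℂ) * z ∈ Δ₁)
    (h₁add : ∀ z ∈ Δ₁, ∀ w ∈ Δ₁, z + w ∈ Δ₁)
    (h₁acute : ∀ z ∈ Δ₁, ∀ w ∈ Δ₁, 0 ≤ (z * (starRingEnd ℂ) w).re)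
    (h₂closed : IsClosed Δ₂) (h₂0 : (0 : ℂ) ∈ Δ₂)
    (h₂cone : ∀ r : ℝ, 0 ≤ r → ∀ z ∈ Δ₂, (r : ℂ) * z ∈ Δ₂)
    (hint : (-Δ₁) ∩ Δ₂ ⊆ {0}) (t : ℂ) (L : ℝ) (hL : 0 ≤ L) :
    Bornology.IsBounded
      ({z : ℂ | ∃ x ∈ Δ₁, ∃ y ∈ Δ₂, z = x + t + y} ∩
        {z : ℂ | ∃ w ∈ Δ₁, ‖z + w‖ ≤ L}) := by
  have hcomp : IsCompact (Metric.sphere (0 : ℂ) 1 ∩ Δ₂) :=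
    (isCompact_sphere 0 1).inter_right h₂closed
  have hdisj : Disjoint (Metric.sphere (0 : ℂ) 1 ∩ Δ₂) (-Δ₁) := by
    rw [Set.disjoint_left]
    rintro a ⟨ha1, ha2⟩ ha3
    have h0 : a = 0 := hint ⟨ha3, ha2⟩
    rw [h0] at ha1
    simp at ha1
  obtain ⟨c, hc, hcd⟩ := Metric.exists_pos_forall_lt_edist hcomp h₁closed.neg hdisj
  have hc' : (0 : ℝ) < c := hc
  have key : ∀ u ∈ Δ₁, ∀ y ∈ Δ₂, c * ‖y‖ ≤ ‖u + y‖ := by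
    intro u hu y hy
    rcases eq_or_ne y 0 with rfl | hy0
    · simp
    have hn : 0 < ‖y‖ := norm_pos_iff.mpr hy0
    have hi : 0 ≤ ‖y‖⁻¹ := by positivity
    have h1 := hcd (((‖y‖⁻¹ : ℝ) : ℂ) * y)
      ⟨by
        rw [mem_sphere_zero_iff_norm, norm_mul, Complex.norm_real, norm_inv, norm_norm]
        exact inv_mul_cancel₀ hn.ne', h₂cone _ hi y hy⟩
      (-(((‖y‖⁻¹ : ℝ) : ℂ) * u)) (by simpa using h₁cone _ hi u hu)
    rw [edist_nndist, ENNReal.coe_lt_coe, ← NNReal.coe_lt_coe, coe_nndist, dist_eq_norm] at h1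
    have h2 : ((‖y‖⁻¹ : ℝ) : ℂ) * y - -(((‖y‖⁻¹ : ℝ) : ℂ) * u)
        = ((‖y‖⁻¹ : ℝ) : ℂ) * (u + y) := by ring
    rw [h2, norm_mul, Complex.norm_real, norm_inv, norm_norm, inv_mul_eq_div,
      lt_div_iff₀ hn] at h1
    exact h1.le
  rw [isBounded_iff_forall_norm_le]
  refine ⟨(L + ‖t‖) + (L + ‖t‖) / c + ‖t‖ + (L + ‖t‖) / c, ?_⟩
  rintro z ⟨⟨x, hx, y, hy, rfl⟩, w, hw, hzw⟩
  have hu := h₁add x hx w hw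
  have hM : ‖(x + w) + y‖ ≤ L + ‖t‖ := by
    have : (x + w) + y = (x + t + y + w) - t := by ring
    rw [this]
    exact (norm_sub_le _ _).trans (by linarith)
  have hyb : ‖y‖ ≤ (L + ‖t‖) / c := by
    rw [le_div_iff₀ hc', mul_comm]
    exact (key _ hu y hy).trans hM
  have hub : ‖x + w‖ ≤ (L + ‖t‖) + ‖y‖ := by
    have : x + w = ((x + w) + y) - y := by ring
    rw [this]
    exact (norm_sub_le _ _).trans (by linarith)
  have hxb : ‖x‖ ≤ ‖x + w‖ := by
    have ha := h₁acute x hx w hw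
    rw [← sq_le_sq₀ (norm_nonneg _) (norm_nonneg _), Complex.sq_norm, Complex.sq_norm,
      Complex.normSq_add]
    have := Complex.normSq_nonneg w
    linarith
  have h3 : ‖x + t + y‖ ≤ ‖x‖ + ‖t‖ + ‖y‖ := norm_add₃_le
  linarith
end

section
/- Let a, b ∈ ℝ with b − a ≤ π/2, let S = { r · exp(θ·I) | r ≥ 0, θ ∈ [a, b] } ⊆ ℂ, let n ∈ ℕ and let z : Fin n → ℂ satisfy z i ∈ S for all i. Then ∑ᵢ ‖z i‖ ≤ √2 · ‖∑ᵢ z i‖. -/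
/-- Finitely many complex numbers lying in a closed sector of opening angle at
most `π/2` satisfy `∑ ‖z i‖ ≤ √2 · ‖∑ z i‖`. -/
theorem stmt_6 (a b : ℝ) (hab : b - a ≤ Real.pi / 2)
    (n : ℕ) (z : Fin n → ℂ)
    (hz : ∀ i, ∃ r θ : ℝ, 0 ≤ r ∧ θ ∈ Set.Icc a b ∧
      z i = (r : ℂ) * Complex.exp ((θ : ℂ) * Complex.I)) :
    ∑ i, ‖z i‖ ≤ Real.sqrt 2 * ‖∑ i, z i‖ := by
  set w : ℂ := Complex.exp (((-((a + b) / 2) : ℝ) : ℂ) * Complex.I) with hw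
  have hwn : ‖w‖ = 1 := Complex.norm_exp_ofReal_mul_I _
  have key : ∀ i, ‖z i‖ ≤ Real.sqrt 2 * (w * z i).re := by
    intro i
    obtain ⟨r, θ, hr, ⟨h1, h2⟩, h⟩ := hz i
    have e : w * z i = (r : ℂ) * Complex.exp (((θ - (a + b) / 2 : ℝ) : ℂ) * Complex.I) := by
      rw [h, hw, mul_left_comm, ← Complex.exp_add]
      congr 2
      push_cast
      ring
    have hn : ‖z i‖ = r := by
      rw [h, norm_mul, Complex.norm_exp_ofReal_mul_I, Complex.norm_real, Real.norm_of_nonneg hr,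
        mul_one]
    have hc : Real.sqrt 2 / 2 ≤ Real.cos (θ - (a + b) / 2) := by
      rw [← Real.cos_pi_div_four, ← Real.cos_abs (θ - (a + b) / 2)]
      apply Real.cos_le_cos_of_nonneg_of_le_pi (abs_nonneg _)
      · linarith [Real.pi_pos]
      · rw [abs_le]
        constructor <;> linarith
    rw [e, hn, Complex.re_ofReal_mul, Complex.exp_ofReal_mul_I_re]
    have hs : Real.sqrt 2 * Real.sqrt 2 = 2 := Real.mul_self_sqrt (by norm_num)
    have h3 : 1 ≤ Real.sqrt 2 * Real.cos (θ - (a + b) / 2) := by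
      nlinarith [mul_le_mul_of_nonneg_left hc (Real.sqrt_nonneg 2)]
    nlinarith [mul_le_mul_of_nonneg_left h3 hr]
  calc ∑ i, ‖z i‖ ≤ ∑ i, Real.sqrt 2 * (w * z i).re := Finset.sum_le_sum fun i _ => key i
    _ = Real.sqrt 2 * (w * ∑ i, z i).re := by
      rw [Finset.mul_sum, Complex.re_sum, Finset.mul_sum]
    _ ≤ Real.sqrt 2 * ‖w * ∑ i, z i‖ :=
      mul_le_mul_of_nonneg_left (Complex.re_le_norm _) (Real.sqrt_nonneg 2)
    _ = Real.sqrt 2 * ‖∑ i, z i‖ := by rw [norm_mul, hwn, one_mul]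
end

section
/- Let Γ be an additive commutative group, B : Γ → Γ → ℤ biadditive with B(γ,γ) = 0, Z : Γ → ℂ an additive homomorphism, and Δ ⊆ ℂ pairwise-acute and closed under addition. Let A_Δ = { a ∈ (Γ →₀ ℂ) | Z(γ) ∈ Δ for every γ in the support of a }, equipped with the twisted convolution ⋆ and the bracket {a,b}(γ) = ∑_{α+β=γ} B(α,β)(−1)^{B(α,β)} a(α) b(β). Then A_Δ is closed under ⋆ and under the bracket; and for every L ≥ 0 the subset I_L = { a ∈ A_Δ | L ≤ ‖Z(γ)‖ for every γ in the support of a } satisfies: for all a ∈ A_Δ and b ∈ I_L, the elements a ⋆ b, b ⋆ a and {a, b} all lie in I_L. -/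
/-- The sign-twisted convolution of finitely supported functions `Γ →₀ ℂ`. -/
noncomputable def twConv {Γ : Type*} [AddCommGroup Γ] (B : Γ → Γ → ℤ)
    (x y : Γ →₀ ℂ) : Γ →₀ ℂ :=
  x.sum fun α cα => y.sum fun β cβ =>
    Finsupp.single (α + β) ((-1 : ℂ) ^ (B α β) * cα * cβ)

/-- The twisted Poisson bracket on `Γ →₀ ℂ`. -/
noncomputable def twBr {Γ : Type*} [AddCommGroup Γ] (B : Γ → Γ → ℤ)
    (x y : Γ →₀ ℂ) : Γ →₀ ℂ :=
  x.sum fun α cα => y.sum fun β cβ =>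
    Finsupp.single (α + β) (((B α β : ℤ) : ℂ) * (-1 : ℂ) ^ (B α β) * cα * cβ)

theorem sum_supp_aux {Γ : Type*} [AddCommGroup Γ] (f : Γ → Γ → ℂ → ℂ → ℂ) (x y : Γ →₀ ℂ)
    (γ : Γ)
    (h : γ ∈ (x.sum fun α cα => y.sum fun β cβ =>
      Finsupp.single (α + β) (f α β cα cβ)).support) :
    ∃ α ∈ x.support, ∃ β ∈ y.support, γ = α + β := by
  classical
  obtain ⟨α, hα, h⟩ := Finset.mem_biUnion.1 (Finsupp.support_sum h)
  obtain ⟨β, hβ, h⟩ := Finset.mem_biUnion.1 (Finsupp.support_sum h)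
  exact ⟨α, hα, β, hβ, Finset.mem_singleton.1 (Finsupp.support_single_subset h)⟩

theorem norm_add_aux (z w : ℂ) (h : 0 ≤ (z * (starRingEnd ℂ) w).re) : ‖w‖ ≤ ‖z + w‖ := by
  have h1 : ‖w‖ ^ 2 ≤ ‖z + w‖ ^ 2 := by
    rw [← Complex.normSq_eq_norm_sq, ← Complex.normSq_eq_norm_sq, Complex.normSq_add]
    have := Complex.normSq_nonneg z
    linarith
  exact (sq_le_sq₀ (norm_nonneg _) (norm_nonneg _)).1 h1

/-- `ℂ_Δ[𝕋₋]` is a Poisson subalgebra and, for an acute `Δ`, the height-`≥ L`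
subspace is a Poisson ideal. -/
theorem stmt_10 (Γ : Type*) [AddCommGroup Γ] (B : Γ → Γ → ℤ)
    (hB₁ : ∀ α α' β : Γ, B (α + α') β = B α β + B α' β)
    (hB₂ : ∀ α β β' : Γ, B α (β + β') = B α β + B α β')
    (hBalt : ∀ γ : Γ, B γ γ = 0)
    (Z : Γ →+ ℂ) (Δ : Set ℂ)
    (hacute : ∀ z ∈ Δ, ∀ w ∈ Δ, 0 ≤ (z * (starRingEnd ℂ) w).re)
    (hadd : ∀ z ∈ Δ, ∀ w ∈ Δ, z + w ∈ Δ)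
    (A : Set (Γ →₀ ℂ)) (hA : A = {x : Γ →₀ ℂ | ∀ γ ∈ x.support, Z γ ∈ Δ}) :
    (∀ x ∈ A, ∀ y ∈ A, twConv B x y ∈ A) ∧
    (∀ x ∈ A, ∀ y ∈ A, twBr B x y ∈ A) ∧
    (∀ L : ℝ, 0 ≤ L → ∀ I : Set (Γ →₀ ℂ),
      I = {x ∈ A | ∀ γ ∈ x.support, L ≤ ‖Z γ‖} →
      ∀ x ∈ A, ∀ y ∈ I,
        twConv B x y ∈ I ∧ twConv B y x ∈ I ∧ twBr B x y ∈ I) := by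
  subst hA
  have key : ∀ x y z : Γ →₀ ℂ, (∀ γ ∈ x.support, Z γ ∈ Δ) → (∀ γ ∈ y.support, Z γ ∈ Δ) →
      (∀ γ ∈ z.support, ∃ α ∈ x.support, ∃ β ∈ y.support, γ = α + β) →
      ∀ γ ∈ z.support, Z γ ∈ Δ := by
    intro x y z hx hy hz γ hγ
    obtain ⟨α, hα, β, hβ, rfl⟩ := hz γ hγ
    rw [map_add]
    exact hadd _ (hx _ hα) _ (hy _ hβ)
  have hc : ∀ x y : Γ →₀ ℂ, ∀ γ ∈ (twConv B x y).support,
      ∃ α ∈ x.support, ∃ β ∈ y.support, γ = α + β := fun x y γ h =>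
    sum_supp_aux (fun α β cα cβ => (-1 : ℂ) ^ (B α β) * cα * cβ) x y γ h
  have hb : ∀ x y : Γ →₀ ℂ, ∀ γ ∈ (twBr B x y).support,
      ∃ α ∈ x.support, ∃ β ∈ y.support, γ = α + β := fun x y γ h =>
    sum_supp_aux (fun α β cα cβ => ((B α β : ℤ) : ℂ) * (-1 : ℂ) ^ (B α β) * cα * cβ) x y γ h
  refine ⟨fun x hx y hy => key x y _ hx hy (hc x y),
    fun x hx y hy => key x y _ hx hy (hb x y), ?_⟩
  rintro L - I rfl x hx y ⟨hy, hyL⟩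
  have key2 : ∀ z : Γ →₀ ℂ,
      (∀ γ ∈ z.support, ∃ α ∈ x.support, ∃ β ∈ y.support, γ = α + β) →
      ∀ γ ∈ z.support, L ≤ ‖Z γ‖ := by
    intro z hz γ hγ
    obtain ⟨α, hα, β, hβ, rfl⟩ := hz γ hγ
    rw [map_add]
    exact (hyL _ hβ).trans (norm_add_aux _ _ (hacute _ (hx _ hα) _ (hy _ hβ)))
  have hc' : ∀ γ ∈ (twConv B y x).support,
      ∃ α ∈ x.support, ∃ β ∈ y.support, γ = α + β := by
    intro γ h
    obtain ⟨α, hα, β, hβ, e⟩ := hc y x γ h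
    exact ⟨β, hβ, α, hα, e.trans (add_comm _ _)⟩
  exact ⟨⟨key x y _ hx hy (hc x y), key2 _ (hc x y)⟩,
    ⟨key x y _ hx hy hc', key2 _ hc'⟩,
    ⟨key x y _ hx hy (hb x y), key2 _ (hb x y)⟩⟩
end

section
/- Let C be a category and let Z assign to every morphism f of C a complex number Z(f) such that Z(f ≫ g) = Z(f) + Z(g) for all composable morphisms f, g. Let Δ ⊆ ℂ be pairwise-acute and closed under addition, and let t₁, t₂ ∈ ℂ. Let a, b : (Σ (x y : C), x ⟶ y) → ℂ be functions such that: Z(f) ∈ t₁ + Δ whenever a(f) ≠ 0 and Z(g) ∈ t₂ + Δ whenever b(g) ≠ 0, and, for every real L, the set of morphisms f with a(f) ≠ 0 and ‖Z(f)‖ < L is finite and likewise for b. Then: (i) for every morphism h : x ⟶ z, the set of factorizations {(y, f : x ⟶ y, g : y ⟶ z) | f ≫ g = h, a(f) ≠ 0, b(g) ≠ 0} is finite; (ii) the function c defined by c(h) = ∑ over this finite set of a(f) · b(g) satisfies Z(h) ∈ t₁ + t₂ + Δ whenever c(h) ≠ 0, and for every real L the set of morphisms h with c(h) ≠ 0 and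 ‖Z(h)‖ < L is finite. -/
open CategoryTheory

theorem acute_norm_le {u v : ℂ} (h : 0 ≤ (u * (starRingEnd ℂ) v).re) :
    ‖u‖ ≤ ‖u + v‖ := by
  rw [← sq_le_sq₀ (norm_nonneg _) (norm_nonneg _), Complex.sq_norm, Complex.sq_norm,
    Complex.normSq_add]
  have := Complex.normSq_nonneg v
  linarith

/-- Proposition 3.4 of the paper (rng structure on Δ-tame submodules), in the
abstract setting of a category with an additive central charge on morphisms:
the product of two Δ-tame locally finite functions on morphisms is defined by a
finite sum over factorizations, is supported over the translated cone
`t₁ + t₂ + Δ`, and is again locally finite. -/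
theorem stmt_11 (C : Type*) [Category C]
    (Z : ∀ ⦃x y : C⦄, (x ⟶ y) → ℂ)
    (hZ : ∀ {x y z : C} (f : x ⟶ y) (g : y ⟶ z), Z (f ≫ g) = Z f + Z g)
    (Δ : Set ℂ)
    (hacute : ∀ z ∈ Δ, ∀ w ∈ Δ, 0 ≤ (z * (starRingEnd ℂ) w).re)
    (hadd : ∀ z ∈ Δ, ∀ w ∈ Δ, z + w ∈ Δ)
    (t₁ t₂ : ℂ)
    (a b : (Σ (x : C) (y : C), x ⟶ y) → ℂ)
    (haΔ : ∀ s, a s ≠ 0 → Z s.2.2 - t₁ ∈ Δ)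
    (hbΔ : ∀ s, b s ≠ 0 → Z s.2.2 - t₂ ∈ Δ)
    (haf : ∀ L : ℝ, {s : Σ (x : C) (y : C), x ⟶ y | a s ≠ 0 ∧ ‖Z s.2.2‖ < L}.Finite)
    (hbf : ∀ L : ℝ, {s : Σ (x : C) (y : C), x ⟶ y | b s ≠ 0 ∧ ‖Z s.2.2‖ < L}.Finite) :
    (∀ (x z : C) (h : x ⟶ z),
      {p : Σ y : C, (x ⟶ y) × (y ⟶ z) |
        p.2.1 ≫ p.2.2 = h ∧ a ⟨x, p.1, p.2.1⟩ ≠ 0 ∧ b ⟨p.1, z, p.2.2⟩ ≠ 0}.Finite) ∧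
    ∀ c : (Σ (x : C) (y : C), x ⟶ y) → ℂ,
      (∀ (x z : C) (h : x ⟶ z),
        c ⟨x, z, h⟩ =
          ∑ᶠ p ∈ {p : Σ y : C, (x ⟶ y) × (y ⟶ z) |
              p.2.1 ≫ p.2.2 = h ∧ a ⟨x, p.1, p.2.1⟩ ≠ 0 ∧ b ⟨p.1, z, p.2.2⟩ ≠ 0},
            a ⟨x, p.1, p.2.1⟩ * b ⟨p.1, z, p.2.2⟩) →
      (∀ s, c s ≠ 0 → Z s.2.2 - (t₁ + t₂) ∈ Δ) ∧
      (∀ L : ℝ, {s : Σ (x : C) (y : C), x ⟶ y | c s ≠ 0 ∧ ‖Z s.2.2‖ < L}.Finite) := by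
  have key : ∀ (x y z : C) (f : x ⟶ y) (g : y ⟶ z), a ⟨x, y, f⟩ ≠ 0 → b ⟨y, z, g⟩ ≠ 0 →
      ‖Z f‖ ≤ ‖Z (f ≫ g)‖ + (‖t₁ + t₂‖ + ‖t₁‖ + ‖t₂‖) ∧
      ‖Z g‖ ≤ ‖Z (f ≫ g)‖ + (‖t₁ + t₂‖ + ‖t₁‖ + ‖t₂‖) := by
    intro x y z f g ha hb
    have h1 : Z f - t₁ ∈ Δ := haΔ _ ha
    have h2 : Z g - t₂ ∈ Δ := hbΔ _ hb
    have e1 := acute_norm_le (hacute _ h1 _ h2)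
    have e2 := acute_norm_le (hacute _ h2 _ h1)
    have q1 : Z f - t₁ + (Z g - t₂) = Z (f ≫ g) - (t₁ + t₂) := by rw [hZ]; ring
    have q2 : Z g - t₂ + (Z f - t₁) = Z (f ≫ g) - (t₁ + t₂) := by rw [hZ]; ring
    rw [q1] at e1
    rw [q2] at e2
    have n0 := norm_sub_le (Z (f ≫ g)) (t₁ + t₂)
    have n1 := norm_sub_norm_le (Z f) t₁
    have n2 := norm_sub_norm_le (Z g) t₂
    have p1 := norm_nonneg t₁
    have p2 := norm_nonneg t₂
    constructor <;> linarith
  refine ⟨?_, ?_⟩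
  · intro x z h
    let M : ℝ := ‖Z h‖ + (‖t₁ + t₂‖ + ‖t₁‖ + ‖t₂‖) + 1
    let F : (Σ y : C, (x ⟶ y) × (y ⟶ z)) →
        (Σ (x : C) (y : C), x ⟶ y) × (Σ (x : C) (y : C), x ⟶ y) :=
      fun p => (⟨x, p.1, p.2.1⟩, ⟨p.1, z, p.2.2⟩)
    refine Set.Finite.of_finite_image (f := F) (((haf M).prod (hbf M)).subset ?_) ?_
    · rintro _ ⟨⟨y, f, g⟩, ⟨hfg, ha, hb⟩, rfl⟩
      dsimp only at hfg ha hb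
      obtain ⟨k1, k2⟩ := key _ _ _ f g ha hb
      rw [hfg] at k1 k2
      exact ⟨⟨ha, lt_of_le_of_lt k1 (lt_add_one _)⟩, ⟨hb, lt_of_le_of_lt k2 (lt_add_one _)⟩⟩
    · rintro ⟨y, f, g⟩ _ ⟨y', f', g'⟩ _ hF
      simp only [F, Prod.mk.injEq, Sigma.mk.injEq, heq_eq_eq, true_and] at hF
      obtain ⟨⟨rfl, hf⟩, -, hg⟩ := hF
      simp only [heq_eq_eq, Sigma.mk.injEq, true_and] at hf hg
      subst hf
      subst hg
      rfl
  · intro c hc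
    have ex : ∀ (x z : C) (h : x ⟶ z), c ⟨x, z, h⟩ ≠ 0 →
        ∃ (y : C) (f : x ⟶ y) (g : y ⟶ z), f ≫ g = h ∧ a ⟨x, y, f⟩ ≠ 0 ∧ b ⟨y, z, g⟩ ≠ 0 := by
      intro x z h hne
      rw [hc] at hne
      obtain ⟨p, hp, -⟩ := exists_ne_zero_of_finsum_mem_ne_zero hne
      exact ⟨p.1, p.2.1, p.2.2, hp⟩
    refine ⟨?_, ?_⟩
    · rintro ⟨x, z, h⟩ hne
      obtain ⟨y, f, g, rfl, ha, hb⟩ := ex x z h hne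
      have := hadd _ (haΔ _ ha) _ (hbΔ _ hb)
      dsimp only at this ⊢
      rw [hZ]
      convert this using 1
      ring
    · intro L
      classical
      let M : ℝ := L + (‖t₁ + t₂‖ + ‖t₁‖ + ‖t₂‖)
      let G : (Σ (x : C) (y : C), x ⟶ y) × (Σ (x : C) (y : C), x ⟶ y) →
          (Σ (x : C) (y : C), x ⟶ y) :=
        fun p => if e : p.1.2.1 = p.2.1 then
          ⟨p.1.1, p.2.2.1, p.1.2.2 ≫ eqToHom e ≫ p.2.2.2⟩ else p.1
      refine (((haf M).prod (hbf M)).image G).subset ?_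
      rintro ⟨x, z, h⟩ ⟨hne, hL⟩
      obtain ⟨y, f, g, rfl, ha, hb⟩ := ex x z h hne
      obtain ⟨k1, k2⟩ := key _ _ _ f g ha hb
      dsimp only at hL
      refine ⟨(⟨x, y, f⟩, ⟨y, z, g⟩), ⟨⟨ha, ?_⟩, ⟨hb, ?_⟩⟩, ?_⟩
      · exact lt_of_le_of_lt k1 (by simp only [M]; linarith)
      · exact lt_of_le_of_lt k2 (by simp only [M]; linarith)
      · simp [G]
end

section
/- Let Γ be an additive commutative group, Z : Γ → ℂ an additive homomorphism, Δ ⊆ ℂ pairwise-acute and closed under addition, and t ∈ ℂ. Let a, b : Γ → ℂ be Z-locally-finite functions such that Z(γ) ∈ t + Δ for every γ in the support of a and for every γ in the support of b. For x : Γ → ℂ define the height h(x) ∈ [0,∞] as the infimum of ‖Z(γ)‖ over the support of x (so h(0) = ∞). Then for every γ ∈ Γ: (i) the set P(γ) = {(α, β) | α + β = γ, a(α) ≠ 0, b(β) ≠ 0} is finite; (ii) if P(γ) is nonempty then h(a) ≤ ‖Z(γ)‖ + 3‖t‖ and h(b) ≤ ‖Z(γ)‖ + 3‖t‖. In particular,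 every γ in the support of the convolution c(γ) = ∑_{P(γ)} a(α) · b(β) satisfies ‖Z(γ)‖ + 3‖t‖ ≥ h(a) and ‖Z(γ)‖ + 3‖t‖ ≥ h(b). -/
open scoped ENNReal

theorem norm_le_norm_add_of_acute12 (z w : ℂ)
    (hzw : 0 ≤ (z * (starRingEnd ℂ) w).re) : ‖z‖ ≤ ‖z + w‖ := by
  rw [← sq_le_sq₀ (norm_nonneg _) (norm_nonneg _), Complex.sq_norm, Complex.sq_norm,
    Complex.normSq_add]
  linarith [Complex.normSq_nonneg w]

/-- The quantitative content of Lemma 3.5 of the paper: for `Z`-locally-finite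
functions `a, b` supported over a translated acute cone `t + Δ`, the set of
factorizations of each `γ` is finite, and when it is nonempty the heights of
`a` and `b` are bounded by `‖Z(γ)‖ + 3‖t‖`; in particular this bound holds for
every `γ` in the support of the convolution. -/
theorem stmt_12 (Γ : Type*) [AddCommGroup Γ] (Z : Γ →+ ℂ)
    (Δ : Set ℂ)
    (hacute : ∀ z ∈ Δ, ∀ w ∈ Δ, 0 ≤ (z * (starRingEnd ℂ) w).re)
    (hadd : ∀ z ∈ Δ, ∀ w ∈ Δ, z + w ∈ Δ)
    (t : ℂ) (a b : Γ → ℂ)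
    (haf : ∀ L : ℝ, {γ : Γ | a γ ≠ 0 ∧ ‖Z γ‖ < L}.Finite)
    (hbf : ∀ L : ℝ, {γ : Γ | b γ ≠ 0 ∧ ‖Z γ‖ < L}.Finite)
    (haΔ : ∀ γ : Γ, a γ ≠ 0 → Z γ - t ∈ Δ)
    (hbΔ : ∀ γ : Γ, b γ ≠ 0 → Z γ - t ∈ Δ)
    (h : (Γ → ℂ) → ℝ≥0∞)
    (hdef : ∀ x : Γ → ℂ, h x = ⨅ γ ∈ {γ : Γ | x γ ≠ 0}, ENNReal.ofReal ‖Z γ‖) :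
    ∀ γ : Γ,
      {p : Γ × Γ | p.1 + p.2 = γ ∧ a p.1 ≠ 0 ∧ b p.2 ≠ 0}.Finite ∧
      ({p : Γ × Γ | p.1 + p.2 = γ ∧ a p.1 ≠ 0 ∧ b p.2 ≠ 0}.Nonempty →
        h a ≤ ENNReal.ofReal (‖Z γ‖ + 3 * ‖t‖) ∧
        h b ≤ ENNReal.ofReal (‖Z γ‖ + 3 * ‖t‖)) ∧
      ((∑ᶠ p ∈ {p : Γ × Γ | p.1 + p.2 = γ ∧ a p.1 ≠ 0 ∧ b p.2 ≠ 0},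
          a p.1 * b p.2) ≠ 0 →
        h a ≤ ENNReal.ofReal (‖Z γ‖ + 3 * ‖t‖) ∧
        h b ≤ ENNReal.ofReal (‖Z γ‖ + 3 * ‖t‖)) := by
  have key : ∀ x y : ℂ, x - t ∈ Δ → y - t ∈ Δ → ‖x‖ ≤ ‖x + y‖ + 3 * ‖t‖ := by
    intro x y hx hy
    have h1 := norm_le_norm_add_of_acute12 _ _ (hacute _ hx _ hy)
    have h2 : ‖x‖ ≤ ‖x - t‖ + ‖t‖ := by
      simpa using norm_add_le (x - t) t
    have h3 : ‖x - t + (y - t)‖ ≤ ‖x + y‖ + ‖t‖ + ‖t‖ := by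
      have e : x - t + (y - t) = x + y - t - t := by ring
      rw [e]
      exact (norm_sub_le _ _).trans (by linarith [norm_sub_le (x + y) t])
    linarith
  intro γ
  have keya : ∀ p : Γ × Γ, p.1 + p.2 = γ → a p.1 ≠ 0 → b p.2 ≠ 0 →
      ‖Z p.1‖ ≤ ‖Z γ‖ + 3 * ‖t‖ ∧ ‖Z p.2‖ ≤ ‖Z γ‖ + 3 * ‖t‖ := by
    intro p hp ha hb
    have h1 := key _ _ (haΔ _ ha) (hbΔ _ hb)
    have h2 := key _ _ (hbΔ _ hb) (haΔ _ ha)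
    rw [add_comm (Z p.2)] at h2
    rw [← map_add, hp] at h1 h2
    exact ⟨h1, h2⟩
  have hne : {p : Γ × Γ | p.1 + p.2 = γ ∧ a p.1 ≠ 0 ∧ b p.2 ≠ 0}.Nonempty →
        h a ≤ ENNReal.ofReal (‖Z γ‖ + 3 * ‖t‖) ∧
        h b ≤ ENNReal.ofReal (‖Z γ‖ + 3 * ‖t‖) := by
    rintro ⟨p, hp, ha, hb⟩
    obtain ⟨h1, h2⟩ := keya p hp ha hb
    rw [hdef, hdef]
    exact ⟨(iInf₂_le p.1 ha).trans (ENNReal.ofReal_le_ofReal h1),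
      (iInf₂_le p.2 hb).trans (ENNReal.ofReal_le_ofReal h2)⟩
  refine ⟨?_, hne, ?_⟩
  · refine ((haf (‖Z γ‖ + 3 * ‖t‖ + 1)).prod (hbf (‖Z γ‖ + 3 * ‖t‖ + 1))).subset ?_
    rintro p ⟨hp, ha, hb⟩
    obtain ⟨h1, h2⟩ := keya p hp ha hb
    exact ⟨⟨ha, by linarith⟩, ⟨hb, by linarith⟩⟩
  · intro hs
    apply hne
    by_contra hc
    rw [Set.not_nonempty_iff_eq_empty] at hc
    rw [hc] at hs
    simp at hs
end

section
/- Let ι be a type and Z : ι → ℂ a function, and let d be the Z-adic metric d(a, b) = 2^{−h(a−b)}, where h(x) ∈ [0,∞] is the infimum of ‖Z(i)‖ over the support of x. Let V = { a : ι → ℂ | for every real L the set { i | a(i) ≠ 0 ∧ ‖Z(i)‖ < L } is finite }. Then: (i) every finitely supported function ι → ℂ belongs to V, and the finitely supported functions are dense in V with respect to d; (ii) V is complete: every d-Cauchy sequence of elements of V converges with respect to d to an element of V. -/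
open scoped ENNReal

/-- Metric form of Lemma 3.1 of the paper: with respect to the `Z`-adic
distance, the space `V` of locally finite formal sums contains the finitely
supported functions as a dense subset and is complete. -/
theorem stmt_14 (ι : Type*) (Z : ι → ℂ)
    (h : (ι → ℂ) → ℝ≥0∞)
    (hdef : ∀ x : ι → ℂ, h x = ⨅ i ∈ {i : ι | x i ≠ 0}, ENNReal.ofReal ‖Z i‖)
    (d : (ι → ℂ) → (ι → ℂ) → ℝ)
    (hd : ∀ x y : ι → ℂ,
      d x y = if h (x - y) = ⊤ then 0 else (2 : ℝ) ^ (-(h (x - y)).toReal))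
    (V : Set (ι → ℂ))
    (hV : V = {a : ι → ℂ | ∀ L : ℝ, {i : ι | a i ≠ 0 ∧ ‖Z i‖ < L}.Finite}) :
    (∀ a : ι → ℂ, {i : ι | a i ≠ 0}.Finite → a ∈ V) ∧
    (∀ a ∈ V, ∀ ε : ℝ, 0 < ε →
      ∃ b : ι → ℂ, {i : ι | b i ≠ 0}.Finite ∧ d a b < ε) ∧
    (∀ u : ℕ → ι → ℂ, (∀ n, u n ∈ V) →
      (∀ ε : ℝ, 0 < ε → ∃ N : ℕ, ∀ m ≥ N, ∀ n ≥ N, d (u m) (u n) < ε) →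
      ∃ a ∈ V, ∀ ε : ℝ, 0 < ε → ∃ N : ℕ, ∀ n ≥ N, d (u n) a < ε) := by
  have A : ∀ (x y : ι → ℂ) (L : ℝ), 0 ≤ L → (∀ i, ‖Z i‖ < L → x i = y i) →
      d x y ≤ (2 : ℝ) ^ (-L) := by
    intro x y L hL hxy
    rw [hd]
    split_ifs with ht
    · positivity
    · have h1 : ENNReal.ofReal L ≤ h (x - y) := by
        rw [hdef]
        refine le_iInf₂ fun i hi => ?_
        apply ENNReal.ofReal_le_ofReal
        by_contra hlt
        exact hi (by simp [hxy i (not_le.mp hlt)])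
      have h2 : L ≤ (h (x - y)).toReal := (ENNReal.ofReal_le_iff_le_toReal ht).mp h1
      exact Real.rpow_le_rpow_of_exponent_le (by norm_num) (by linarith)
  have B : ∀ (x y : ι → ℂ) (L : ℝ), d x y < (2 : ℝ) ^ (-L) →
      ∀ i, ‖Z i‖ ≤ L → x i = y i := by
    intro x y L hlt i hi
    by_contra hne
    have h1 : h (x - y) ≤ ENNReal.ofReal ‖Z i‖ := by
      rw [hdef]
      exact iInf₂_le i (by simpa [sub_eq_zero] using hne)
    have ht : h (x - y) ≠ ⊤ := ne_top_of_le_ne_top ENNReal.ofReal_ne_top h1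
    rw [hd, if_neg ht] at hlt
    have h2 : (h (x - y)).toReal ≤ ‖Z i‖ :=
      ENNReal.toReal_le_of_le_ofReal (norm_nonneg _) h1
    have h3 : (2 : ℝ) ^ (-L) ≤ (2 : ℝ) ^ (-(h (x - y)).toReal) :=
      Real.rpow_le_rpow_of_exponent_le (by norm_num) (by linarith)
    linarith
  have C : ∀ ε : ℝ, 0 < ε → ∃ L : ℝ, 0 ≤ L ∧ (2 : ℝ) ^ (-L) < ε := by
    intro ε hε
    obtain ⟨n, hn⟩ := exists_pow_lt_of_lt_one hε (by norm_num : (2⁻¹ : ℝ) < 1)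
    refine ⟨n, by positivity, ?_⟩
    rw [Real.rpow_neg (by norm_num), Real.rpow_natCast, ← inv_pow]
    exact hn
  subst hV
  refine ⟨?_, ?_, ?_⟩
  · intro a ha L
    exact ha.subset fun i hi => hi.1
  · intro a ha ε hε
    obtain ⟨L, hL, hLε⟩ := C ε hε
    classical
    refine ⟨fun i => if ‖Z i‖ < L then a i else 0, ?_, ?_⟩
    · refine (ha L).subset fun i hi => ?_
      by_cases hz : ‖Z i‖ < L
      · exact ⟨by simpa [hz] using hi, hz⟩
      · exact absurd (by simp [hz]) hi
    · exact (A _ _ L hL fun i hi => by simp [hi]).trans_lt hLε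
  · intro u hu hc
    have hN : ∀ L : ℝ, ∃ N : ℕ, ∀ m ≥ N, ∀ n ≥ N, ∀ i, ‖Z i‖ ≤ L → u m i = u n i := by
      intro L
      obtain ⟨N, hN⟩ := hc ((2 : ℝ) ^ (-L)) (by positivity)
      exact ⟨N, fun m hm n hn => B _ _ L (hN m hm n hn)⟩
    choose N hN using hN
    have key : ∀ (L : ℝ) (n : ℕ), n ≥ N L → ∀ i, ‖Z i‖ ≤ L → u n i = u (N ‖Z i‖) i := by
      intro L n hn i hi
      rw [hN L n hn (max n (N ‖Z i‖)) (hn.le.trans (le_max_left _ _)) i hi]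
      exact hN ‖Z i‖ _ (le_max_right _ _) _ le_rfl i le_rfl
    refine ⟨fun i => u (N ‖Z i‖) i, ?_, ?_⟩
    · intro L
      refine (hu (N L) L).subset fun i hi => ⟨?_, hi.2⟩
      rw [key L (N L) le_rfl i hi.2.le]
      exact hi.1
    · intro ε hε
      obtain ⟨L, hL, hLε⟩ := C ε hε
      exact ⟨N L, fun n hn => (A _ _ L hL fun i hi => key L n hn i hi.le).trans_lt hLε⟩
end

section
/- Let Γ be an additive commutative group and Z : Γ → ℂ an additive homomorphism. Let Δ₁ ⊆ ℂ be a closed cone that is closed under addition and pairwise-acute, let Δ₂ ⊆ ℂ be a closed cone with (−Δ₁) ∩ Δ₂ ⊆ {0}, and let t ∈ ℂ. Let a : Γ → ℂ be Z-locally-finite with Z(γ) ∈ Δ₁ whenever a(γ) ≠ 0, and let b : Γ → ℂ be Z-locally-finite with Z(γ) ∈ Δ₁ + t + Δ₂ whenever b(γ) ≠ 0. Then for every γ ∈ Γ the set {(α, β) | α + β = γ, a(α) ≠ 0, b(β) ≠ 0} is finite, and the convolution c(γ) = ∑ over this set of a(α) · b(β) is Z-locally-finite and satisfies Z(γ) ∈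 Δ₁ + t + Δ₂ whenever c(γ) ≠ 0. -/
/-- Module-structure claim of Lemma 3.6 of the paper: for `a` supported (via
`Z`) in a closed, additively closed, pairwise-acute cone `Δ₁` and `b` supported
in `Δ₁ + t + Δ₂`, where `Δ₂` is a closed cone meeting `−Δ₁` only at `0`, the
convolution is defined by finite sums, is `Z`-locally-finite, and is again
supported in `Δ₁ + t + Δ₂`. -/
theorem stmt_15 (Γ : Type*) [AddCommGroup Γ] (Z : Γ →+ ℂ)
    (Δ₁ Δ₂ : Set ℂ)
    (h₁closed : IsClosed Δ₁) (h₁0 : (0 : ℂ) ∈ Δ₁)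
    (h₁cone : ∀ r : ℝ, 0 ≤ r → ∀ z ∈ Δ₁, (r : ℂ) * z ∈ Δ₁)
    (h₁add : ∀ z ∈ Δ₁, ∀ w ∈ Δ₁, z + w ∈ Δ₁)
    (h₁acute : ∀ z ∈ Δ₁, ∀ w ∈ Δ₁, 0 ≤ (z * (starRingEnd ℂ) w).re)
    (h₂closed : IsClosed Δ₂) (h₂0 : (0 : ℂ) ∈ Δ₂)
    (h₂cone : ∀ r : ℝ, 0 ≤ r → ∀ z ∈ Δ₂, (r : ℂ) * z ∈ Δ₂)
    (hint : (-Δ₁) ∩ Δ₂ ⊆ {0})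
    (t : ℂ) (a b : Γ → ℂ)
    (haf : ∀ L : ℝ, {γ : Γ | a γ ≠ 0 ∧ ‖Z γ‖ < L}.Finite)
    (hbf : ∀ L : ℝ, {γ : Γ | b γ ≠ 0 ∧ ‖Z γ‖ < L}.Finite)
    (haΔ : ∀ γ : Γ, a γ ≠ 0 → Z γ ∈ Δ₁)
    (hbΔ : ∀ γ : Γ, b γ ≠ 0 → ∃ x ∈ Δ₁, ∃ y ∈ Δ₂, Z γ = x + t + y) :
    (∀ γ : Γ, {p : Γ × Γ | p.1 + p.2 = γ ∧ a p.1 ≠ 0 ∧ b p.2 ≠ 0}.Finite) ∧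
    ∀ c : Γ → ℂ,
      (∀ γ : Γ, c γ = ∑ᶠ p ∈ {p : Γ × Γ | p.1 + p.2 = γ ∧ a p.1 ≠ 0 ∧ b p.2 ≠ 0},
        a p.1 * b p.2) →
      (∀ L : ℝ, {γ : Γ | c γ ≠ 0 ∧ ‖Z γ‖ < L}.Finite) ∧
      (∀ γ : Γ, c γ ≠ 0 → ∃ x ∈ Δ₁, ∃ y ∈ Δ₂, Z γ = x + t + y) := by
  obtain ⟨k, hk, hkb⟩ : ∃ k : ℝ, 0 < k ∧ ∀ u ∈ Δ₁, ∀ y ∈ Δ₂, k * ‖u‖ ≤ ‖u + y‖ := by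
    have hS : IsCompact (Δ₁ ∩ Metric.sphere (0 : ℂ) 1) :=
      (isCompact_sphere (0 : ℂ) 1).inter_left h₁closed
    rcases (Δ₁ ∩ Metric.sphere (0 : ℂ) 1).eq_empty_or_nonempty with he | hne
    · refine ⟨1, one_pos, fun u hu y hy => ?_⟩
      by_cases h0 : u = 0
      · subst h0; simp
      · exfalso
        have hm : ((‖u‖⁻¹ : ℝ) : ℂ) * u ∈ Δ₁ ∩ Metric.sphere (0 : ℂ) 1 := by
          refine ⟨h₁cone _ (by positivity) u hu, ?_⟩
          have : ‖u‖ ≠ 0 := by simpa using h0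
          simp [this]
        rw [he] at hm
        exact hm
    · obtain ⟨v, hv, hmin⟩ := hS.exists_isMinOn hne
        (f := fun u => Metric.infDist (-u) Δ₂)
        ((Metric.continuous_infDist_pt Δ₂).comp continuous_neg).continuousOn
      have hv1 : ‖v‖ = 1 := by simpa using hv.2
      refine ⟨Metric.infDist (-v) Δ₂, ?_, fun u hu y hy => ?_⟩
      · refine (h₂closed.notMem_iff_infDist_pos ⟨0, h₂0⟩).1 fun hmem => ?_
        have h := hint ⟨by simpa using hv.1, hmem⟩
        have h' : v = 0 := by simpa using h
        simp [h'] at hv1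
      · by_cases h0 : u = 0
        · subst h0; simp
        · have hn : 0 < ‖u‖ := by simpa using h0
          have hm : ((‖u‖⁻¹ : ℝ) : ℂ) * u ∈ Δ₁ ∩ Metric.sphere (0 : ℂ) 1 := by
            refine ⟨h₁cone _ (by positivity) u hu, ?_⟩
            simp [hn.ne']
          have h1 : Metric.infDist (-v) Δ₂ ≤
              Metric.infDist (-(((‖u‖⁻¹ : ℝ) : ℂ) * u)) Δ₂ := hmin hm
          have h2 := Metric.infDist_le_dist_of_mem (x := -(((‖u‖⁻¹ : ℝ) : ℂ) * u))
            (h₂cone ‖u‖⁻¹ (by positivity) y hy)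
          have h3 : dist (-(((‖u‖⁻¹ : ℝ) : ℂ) * u)) (((‖u‖⁻¹ : ℝ) : ℂ) * y)
              = ‖u‖⁻¹ * ‖u + y‖ := by
            rw [dist_eq_norm, show -(((‖u‖⁻¹ : ℝ) : ℂ) * u) - ((‖u‖⁻¹ : ℝ) : ℂ) * y
              = -(((‖u‖⁻¹ : ℝ) : ℂ) * (u + y)) by ring, norm_neg, norm_mul]
            simp
          have h4 : Metric.infDist (-v) Δ₂ ≤ ‖u‖⁻¹ * ‖u + y‖ := by linarith
          calc _ ≤ (‖u‖⁻¹ * ‖u + y‖) * ‖u‖ := by gcongr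
            _ = ‖u + y‖ := by field_simp
  have hac : ∀ u ∈ Δ₁, ∀ x ∈ Δ₁, ‖u‖ ≤ ‖u + x‖ := by
    intro u hu x hx
    have h := h₁acute u hu x hx
    refine le_of_sq_le_sq ?_ (norm_nonneg _)
    rw [← Complex.normSq_eq_norm_sq, ← Complex.normSq_eq_norm_sq, Complex.normSq_add]
    have := Complex.normSq_nonneg x
    linarith
  have hT : ∀ L : ℝ, {p : Γ × Γ | a p.1 ≠ 0 ∧ b p.2 ≠ 0 ∧ ‖Z (p.1 + p.2)‖ < L}.Finite := by
    intro L
    set M := (L + ‖t‖) / k with hM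
    refine ((haf (M + 1)).prod (hbf (L + M))).subset ?_
    rintro ⟨α, β⟩ ⟨ha, hb, hL⟩
    simp only at ha hb hL
    obtain ⟨x, hx, y, hy, hxy⟩ := hbΔ β hb
    have hu := haΔ α ha
    have e : Z (α + β) = (Z α + x + y) + t := by rw [map_add, hxy]; ring
    have h1 : ‖Z α + x + y‖ ≤ ‖Z (α + β)‖ + ‖t‖ := by
      have := norm_sub_le (Z (α + β)) t
      rwa [e, add_sub_cancel_right, ← e] at this
    have h2 := hkb _ (h₁add _ hu _ hx) y hy
    have h3 := hac _ hu _ hx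
    have h4 : ‖Z α‖ ≤ M := by
      rw [hM, le_div_iff₀ hk]
      nlinarith
    have h5 : ‖Z β‖ ≤ ‖Z (α + β)‖ + ‖Z α‖ := by
      have := norm_sub_le (Z (α + β)) (Z α)
      rwa [← map_sub, add_sub_cancel_left] at this
    exact ⟨⟨ha, by simp only; linarith⟩, ⟨hb, by simp only; linarith⟩⟩
  refine ⟨fun γ => (hT (‖Z γ‖ + 1)).subset ?_, fun c hc => ?_⟩
  · rintro p ⟨rfl, h1, h2⟩
    exact ⟨h1, h2, by linarith⟩
  have hex : ∀ γ, c γ ≠ 0 → ∃ p : Γ × Γ, p.1 + p.2 = γ ∧ a p.1 ≠ 0 ∧ b p.2 ≠ 0 := by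
    intro γ h
    rw [hc γ] at h
    obtain ⟨p, hp, -⟩ := exists_ne_zero_of_finsum_mem_ne_zero h
    exact ⟨p, hp⟩
  refine ⟨fun L => ((hT L).image fun p => p.1 + p.2).subset ?_, fun γ h => ?_⟩
  · rintro γ ⟨h, hL⟩
    obtain ⟨p, rfl, h1, h2⟩ := hex γ h
    exact ⟨p, ⟨h1, h2, hL⟩, rfl⟩
  · obtain ⟨p, rfl, h1, h2⟩ := hex γ h
    obtain ⟨x, hx, y, hy, hxy⟩ := hbΔ _ h2
    exact ⟨Z p.1 + x, h₁add _ (haΔ _ h1) _ hx, y, hy, by rw [map_add, hxy]; ring⟩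
end
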